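/- (Right twist Chamber Ansatz, type A.) In the Marsh–Rietsch setup over ℂ with all parameters t_r ≠ 0: the matrix gᵀ·ẇ admits a UDL factorization; set y⃗ := [gᵀẇ]_L^+. Then for every r ∈ J°: t_r · Δ^{A_r(i_r)}_{B_r(i_r)}(y⃗) · Δ^{A'_r}_{B'_r}(y⃗) = Δ^{A_r(i_r−1)}_{B_r(i_r−1)}(y⃗) · Δ^{A_r(i_r+1)}_{B_r(i_r+1)}(y⃗), where for 0 ≤ k ≤ n we set A_r(k) := (s^v_{i_m}∘s^v_{i_{m−1}}∘···∘s^v_{i_{r+1}})({1,…,k}) and B_r(k) := (s_{i_m}∘s_{i_{m−1}}∘···∘s_{i_{r+1}})({1,…,k}) (with the convention Δ^{A_r(0)}_{B_r(0)}(y⃗) := 1), and A'_r := (s^v_{i_m}∘s^v_{i_{m−1}}∘···∘s^v_{i_r})({1,…,i_r}), B'_r := (s_{i_m}∘s_{i_{m−1}}∘···∘s_{i_r})({1,…,i_r}). -/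

import Mathlib

open Matrix Finset

namespace Paper

open scoped Classical

noncomputable section

variable {K : Type*} [Field K] {n m : ℕ}

/-- `N`: upper unitriangular matrices. -/
def IsN (g : Matrix (Fin n) (Fin n) K) : Prop :=
  (∀ i, g i i = 1) ∧ ∀ i j : Fin n, j < i → g i j = 0

/-- `N₋`: lower unitriangular matrices. -/
def IsNm (g : Matrix (Fin n) (Fin n) K) : Prop :=
  (∀ i, g i i = 1) ∧ ∀ i j : Fin n, i < j → g i j = 0

/-- `B`: upper triangular matrices of determinant 1. -/
def IsB (g : Matrix (Fin n) (Fin n) K) : Prop :=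
  g.det = 1 ∧ ∀ i j : Fin n, j < i → g i j = 0

/-- `B₋`: lower triangular matrices of determinant 1. -/
def IsBm (g : Matrix (Fin n) (Fin n) K) : Prop :=
  g.det = 1 ∧ ∀ i j : Fin n, i < j → g i j = 0

/-- `H`: diagonal matrices of determinant 1. -/
def IsH (g : Matrix (Fin n) (Fin n) K) : Prop :=
  g.det = 1 ∧ ∀ i j : Fin n, i ≠ j → g i j = 0

/-- UDL factorization: `g = yp * y0 * ym` with `yp ∈ N`, `y0 ∈ H`, `ym ∈ N₋`. -/
def UDL (g yp y0 ym : Matrix (Fin n) (Fin n) K) : Prop :=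
  IsN yp ∧ IsH y0 ∧ IsNm ym ∧ g = yp * y0 * ym

/-- LDU factorization: `g = zm * z0 * zp` with `zm ∈ N₋`, `z0 ∈ H`, `zp ∈ N`. -/
def LDU (g zm z0 zp : Matrix (Fin n) (Fin n) K) : Prop :=
  IsNm zm ∧ IsH z0 ∧ IsN zp ∧ g = zm * z0 * zp

/-- The signed permutation matrix `v̇`. -/
def pdot (v : Equiv.Perm (Fin n)) : Matrix (Fin n) (Fin n) K :=
  Matrix.of fun a b : Fin n =>
    if a = v b then
      (-1 : K) ^ (univ.filter fun k : Fin n => b < k ∧ v k < v b).card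
    else 0

/-- Membership in the double coset `B₋ w B₋`. -/
def InBmWBm (w : Equiv.Perm (Fin n)) (g : Matrix (Fin n) (Fin n) K) : Prop :=
  ∃ b₁ b₂ : Matrix (Fin n) (Fin n) K, IsBm b₁ ∧ IsBm b₂ ∧ g = b₁ * pdot w * b₂

/-- `Δ^I_J(g)`: the minor with row set `I` and column set `J` (junk value 0 if sizes differ). -/
def minor (g : Matrix (Fin n) (Fin n) K) (I J : Finset (Fin n)) : K :=
  if h : I.card = J.card then
    Matrix.det (Matrix.of fun a b : Fin I.card =>
      g (I.orderEmbOfFin rfl a) (J.orderEmbOfFin h.symm b))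
  else 0

/-- All right-aligned flag minors of `g` are nonnegative. -/
def RightFlagNonneg (g : Matrix (Fin n) (Fin n) ℝ) : Prop :=
  ∀ I : Finset (Fin n),
    0 ≤ minor g I (univ.filter fun j : Fin n => n - I.card ≤ (j : ℕ))

/-- All top-aligned flag minors of `g` are nonnegative. -/
def TopFlagNonneg (g : Matrix (Fin n) (Fin n) ℝ) : Prop :=
  ∀ J : Finset (Fin n),
    0 ≤ minor g (univ.filter fun i : Fin n => (i : ℕ) < J.card) J

/-- `x_i(t)` (with 1-based `i`): `Id + t·E_{i,i+1}`. -/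
def xmat (i : ℕ) (t : K) : Matrix (Fin n) (Fin n) K :=
  Matrix.of fun a b : Fin n =>
    if a = b then 1 else if (a : ℕ) + 1 = i ∧ (b : ℕ) = i then t else 0

/-- `y_i(t)` (with 1-based `i`): `Id + t·E_{i+1,i}`. -/
def ymat (i : ℕ) (t : K) : Matrix (Fin n) (Fin n) K :=
  Matrix.of fun a b : Fin n =>
    if a = b then 1 else if (a : ℕ) = i ∧ (b : ℕ) + 1 = i then t else 0

/-- `ṡ_i` (with 1-based `i`). -/
def sdot (i : ℕ) : Matrix (Fin n) (Fin n) K :=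
  Matrix.of fun a b : Fin n =>
    if (a : ℕ) + 1 = i ∧ (b : ℕ) = i then 1
    else if (a : ℕ) = i ∧ (b : ℕ) + 1 = i then -1
    else if a = b ∧ (a : ℕ) + 1 ≠ i ∧ (a : ℕ) ≠ i then 1
    else 0

/-- The adjacent transposition `s_i` (with 1-based `i`); identity if out of range. -/
def sperm (n : ℕ) (i : ℕ) : Equiv.Perm (Fin n) :=
  if h : i < n then
    Equiv.swap ⟨i - 1, Nat.lt_of_le_of_lt (Nat.sub_le i 1) h⟩ ⟨i, h⟩
  else 1

/-- `ℓ(w)`: the number of inversions of `w`. -/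
def len (w : Equiv.Perm (Fin n)) : ℕ :=
  (univ.filter fun p : Fin n × Fin n => p.1 < p.2 ∧ w p.2 < w p.1).card

/-- `vseq ii v k = v_{(m-k)}`: the rightmost (positive distinguished) subexpression recursion. -/
def vseq (ii : Fin m → ℕ) (v : Equiv.Perm (Fin n)) : ℕ → Equiv.Perm (Fin n)
  | 0 => v
  | k + 1 =>
    if h : m - k - 1 < m then
      if len (vseq ii v k * sperm n (ii ⟨m - k - 1, h⟩)) < len (vseq ii v k) then
        vseq ii v k * sperm n (ii ⟨m - k - 1, h⟩)
      else vseq ii v k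
    else vseq ii v k

/-- `r ∈ J°` (0-based `r`, corresponding to the 1-based index `r+1`). -/
def inJ (ii : Fin m → ℕ) (v : Equiv.Perm (Fin n)) (r : Fin m) : Prop :=
  vseq ii v (m - (r : ℕ)) = vseq ii v (m - (r : ℕ) - 1)

/-- The list `[s_{i_1}, …, s_{i_m}]` of adjacent transpositions. -/
def sPermList (n : ℕ) (ii : Fin m → ℕ) : List (Equiv.Perm (Fin n)) :=
  List.ofFn fun r => sperm n (ii r)

/-- The list `[s^v_{i_1}, …, s^v_{i_m}]`. -/
def svPermList (ii : Fin m → ℕ) (v : Equiv.Perm (Fin n)) : List (Equiv.Perm (Fin n)) :=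
  List.ofFn fun r => if inJ ii v r then 1 else sperm n (ii r)

/-- The factors `g_1, …, g_m` of the Marsh–Rietsch element. -/
def mrgList (ii : Fin m → ℕ) (v : Equiv.Perm (Fin n)) (t : Fin m → K) :
    List (Matrix (Fin n) (Fin n) K) :=
  List.ofFn fun r => if inJ ii v r then xmat (ii r) (t r) else sdot (ii r)

/-- The Marsh–Rietsch element `g = g_1 ⋯ g_m`. -/
def mrg (ii : Fin m → ℕ) (v : Equiv.Perm (Fin n)) (t : Fin m → K) :
    Matrix (Fin n) (Fin n) K :=
  (mrgList ii v t).prod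

/-- The list `[ṡ_{i_1}, …, ṡ_{i_m}]`. -/
def sdotList (n : ℕ) (ii : Fin m → ℕ) : List (Matrix (Fin n) (Fin n) K) :=
  List.ofFn fun r => sdot (ii r)

/-- `ẇ = ṡ_{i_1} ⋯ ṡ_{i_m}`. -/
def wMR (n : ℕ) (ii : Fin m → ℕ) : Matrix (Fin n) (Fin n) K :=
  (sdotList n ii).prod

def eps (q a : Fin n) : K := if a = q then -1 else 1

lemma eps_mul_self (q a : Fin n) : (eps q a * eps q a : K) = 1 := by
  unfold eps; split_ifs <;> simp

lemma eps_ne (q a : Fin n) : (eps q a : K) ≠ 0 := by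
  unfold eps; split_ifs <;> simp

lemma sdot_apply {p q : Fin n} (h : (p : ℕ) + 1 = q) (a b : Fin n) :
    (sdot (q : ℕ) : Matrix (Fin n) (Fin n) K) a b
      = if b = Equiv.swap p q a then eps q a else 0 := by
  unfold sdot eps
  simp only [Matrix.of_apply, Equiv.swap_apply_def, Fin.ext_iff]
  split_ifs <;> first | rfl | (exfalso; grind)

lemma sdot_mul_apply {p q : Fin n} (h : (p : ℕ) + 1 = q) (X : Matrix (Fin n) (Fin n) K)
    (a b : Fin n) :
    (sdot (q : ℕ) * X : Matrix (Fin n) (Fin n) K) a b = eps q a * X (Equiv.swap p q a) b := by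
  simp [Matrix.mul_apply, sdot_apply h]

lemma mul_sdotT_apply {p q : Fin n} (h : (p : ℕ) + 1 = q) (X : Matrix (Fin n) (Fin n) K)
    (a b : Fin n) :
    (X * (sdot (q : ℕ))ᵀ : Matrix (Fin n) (Fin n) K) a b = X a (Equiv.swap p q b) * eps q b := by
  simp [Matrix.mul_apply, sdot_apply h]

lemma sdotT_apply {p q : Fin n} (h : (p : ℕ) + 1 = q) (a b : Fin n) :
    (sdot (q : ℕ) : Matrix (Fin n) (Fin n) K)ᵀ a b
      = if b = Equiv.swap p q a then eps q (Equiv.swap p q a) else 0 := by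
  rw [Matrix.transpose_apply, sdot_apply h]
  by_cases hb : b = Equiv.swap p q a
  · subst hb; simp
  · rw [if_neg hb, if_neg]
    rintro rfl; simp at hb

lemma sdotT_mul_apply {p q : Fin n} (h : (p : ℕ) + 1 = q) (X : Matrix (Fin n) (Fin n) K)
    (a b : Fin n) :
    ((sdot (q : ℕ))ᵀ * X : Matrix (Fin n) (Fin n) K) a b = eps q (Equiv.swap p q a) * X (Equiv.swap p q a) b := by
  simp only [Matrix.mul_apply, sdotT_apply h, ite_mul, zero_mul, Finset.sum_ite_eq', Finset.mem_univ, if_true]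

lemma mul_sdot_apply {p q : Fin n} (h : (p : ℕ) + 1 = q) (X : Matrix (Fin n) (Fin n) K)
    (a b : Fin n) :
    (X * sdot (q : ℕ) : Matrix (Fin n) (Fin n) K) a b = X a (Equiv.swap p q b) * eps q (Equiv.swap p q b) := by
  have := sdotT_mul_apply h Xᵀ b a
  rw [← Matrix.transpose_mul, Matrix.transpose_apply, Matrix.transpose_apply] at this
  rw [this, mul_comm]

lemma sdot_mul_sdotT {p q : Fin n} (h : (p : ℕ) + 1 = q) :
    (sdot (q : ℕ) * (sdot (q : ℕ))ᵀ : Matrix (Fin n) (Fin n) K) = 1 := by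
  ext a b
  rw [sdot_mul_apply h, sdotT_apply h]
  simp only [Equiv.swap_apply_self, Matrix.one_apply]
  by_cases hb : b = a
  · subst hb; simp [eps_mul_self]
  · rw [if_neg hb, if_neg (fun h => hb h.symm), mul_zero]

lemma sdotT_mul_sdot {p q : Fin n} (h : (p : ℕ) + 1 = q) :
    ((sdot (q : ℕ))ᵀ * (sdot (q : ℕ)) : Matrix (Fin n) (Fin n) K) = 1 :=
  mul_eq_one_comm.mp (sdot_mul_sdotT h)

lemma xmat_apply {p q : Fin n} (h : (p : ℕ) + 1 = q) (c : K) (a b : Fin n) :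
    (xmat (q : ℕ) c : Matrix (Fin n) (Fin n) K) a b
      = (if a = b then 1 else 0) + (if a = p ∧ b = q then c else 0) := by
  unfold xmat
  simp only [Matrix.of_apply, Fin.ext_iff]
  split_ifs <;> first | (exfalso; omega) | simp

lemma xmat_eq {p q : Fin n} (h : (p : ℕ) + 1 = q) (c : K) :
    (xmat (q : ℕ) c : Matrix (Fin n) (Fin n) K) = Matrix.transvection p q c := by
  ext a b
  rw [xmat_apply h, Matrix.transvection, Matrix.add_apply, Matrix.one_apply, Matrix.single_apply]
  simp [eq_comm]

lemma mul_xmat_apply {p q : Fin n} (h : (p : ℕ) + 1 = q) (c : K) (X : Matrix (Fin n) (Fin n) K)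
    (a b : Fin n) :
    (X * xmat (q : ℕ) c : Matrix (Fin n) (Fin n) K) a b = X a b + if b = q then X a p * c else 0 := by
  simp only [Matrix.mul_apply, xmat_apply h, mul_add, Finset.sum_add_distrib]
  congr 1
  · simp
  · by_cases hb : b = q <;> simp [hb]

lemma xmat_mul_apply {p q : Fin n} (h : (p : ℕ) + 1 = q) (c : K) (X : Matrix (Fin n) (Fin n) K)
    (a b : Fin n) :
    (xmat (q : ℕ) c * X : Matrix (Fin n) (Fin n) K) a b = X a b + if a = p then c * X q b else 0 := by
  simp only [Matrix.mul_apply, xmat_apply h, add_mul, Finset.sum_add_distrib]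
  congr 1
  · simp
  · by_cases hb : a = p <;> simp [hb]

lemma xmat_mul_neg {p q : Fin n} (h : (p : ℕ) + 1 = q) (c : K) :
    (xmat (q : ℕ) (-c) * xmat (q : ℕ) c : Matrix (Fin n) (Fin n) K) = 1 := by
  have hne : p ≠ q := by rintro rfl; omega
  rw [xmat_eq h, xmat_eq h, Matrix.transvection_mul_transvection_same p q hne]
  simp

lemma det_xmat {p q : Fin n} (h : (p : ℕ) + 1 = q) (c : K) :
    (xmat (q : ℕ) c : Matrix (Fin n) (Fin n) K).det = 1 := by
  have hne : p ≠ q := by rintro rfl; omega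
  rw [xmat_eq h, Matrix.det_transvection_of_ne p q hne]

lemma det_sswap {ι : Type*} [Fintype ι] [DecidableEq ι] (p q : ι) (hpq : p ≠ q)
    (Y : Matrix ι ι K) :
    Matrix.det (Matrix.of fun a b => (if a = q then (-1 : K) else 1) * Y (Equiv.swap p q a) b)
      = Y.det := by
  have := Matrix.det_mul_column (fun a => (if a = q then (-1 : K) else 1))
    (Y.submatrix (Equiv.swap p q) id)
  simp only [Matrix.submatrix_apply, id] at this
  rw [this, Matrix.det_permute, Equiv.Perm.sign_swap hpq]
  simp

lemma det_sdot {p q : Fin n} (h : (p : ℕ) + 1 = q) :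
    (sdot (q : ℕ) : Matrix (Fin n) (Fin n) K).det = 1 := by
  have hne : p ≠ q := by rintro rfl; omega
  have := det_sswap (K := K) p q hne 1
  rw [Matrix.det_one] at this
  rw [← this]
  congr 1
  ext a b
  have := sdot_mul_apply (K := K) h 1 a b
  rw [mul_one] at this
  rw [this]
  simp [eps]

lemma swap_lt {p q : Fin n} (h : (p : ℕ) + 1 = q) {x y : Fin n} (hxy : x < y)
    (hne : ¬ (x = p ∧ y = q)) : Equiv.swap p q x < Equiv.swap p q y := by
  simp only [Equiv.swap_apply_def, Fin.ext_iff, Fin.lt_def] at *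
  split_ifs <;> omega

lemma len_mul_swap {p q : Fin n} (h : (p : ℕ) + 1 = q) (u : Equiv.Perm (Fin n))
    (hu : u p < u q) : len (u * Equiv.swap p q) = len u + 1 := by
  have hlt : p < q := by rw [Fin.lt_def]; omega
  unfold len
  have e : (univ.filter fun x : Fin n × Fin n =>
        x.1 < x.2 ∧ (u * Equiv.swap p q) x.2 < (u * Equiv.swap p q) x.1)
      = insert (p, q) ((univ.filter fun x : Fin n × Fin n => x.1 < x.2 ∧ u x.2 < u x.1).map
        (Equiv.prodCongr (Equiv.swap p q) (Equiv.swap p q)).toEmbedding) := by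
    ext ⟨x, y⟩
    rw [Finset.mem_insert, Finset.mem_map_equiv, Finset.mem_filter, Finset.mem_filter]
    simp only [ Finset.mem_univ, true_and, Equiv.Perm.mul_apply, Prod.mk.injEq,
      Equiv.prodCongr_symm, Equiv.symm_swap, Equiv.prodCongr_apply, Prod.map]
    constructor
    · rintro ⟨h1, h2⟩
      by_cases hc : x = p ∧ y = q
      · exact Or.inl hc
      · exact Or.inr ⟨swap_lt h h1 hc, h2⟩
    · rintro (⟨rfl, rfl⟩ | ⟨h1, h2⟩)
      · simp [hlt, hu]
      · refine ⟨?_, h2⟩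
        have := swap_lt h h1 ?_
        · simpa using this
        · rintro ⟨h3, h4⟩
          rw [h3, h4] at h2
          exact absurd h2 (not_lt.mpr hu.le)
  rw [e, Finset.card_insert_of_notMem, Finset.card_map]
  rw [Finset.mem_map_equiv]
  simp only [Finset.mem_filter, Equiv.prodCongr_symm, Equiv.symm_swap, Equiv.prodCongr_apply,
    Prod.map, Equiv.swap_apply_left, Equiv.swap_apply_right]
  rintro ⟨-, h1, -⟩
  exact absurd h1 (not_lt.mpr hlt.le)

lemma len_mul_swap' {p q : Fin n} (h : (p : ℕ) + 1 = q) (u : Equiv.Perm (Fin n))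
    (hu : u q < u p) : len (u * Equiv.swap p q) + 1 = len u := by
  rw [← len_mul_swap h (u * Equiv.swap p q) (by simpa using hu)]
  simp [mul_assoc]

def SuppR (u : Fin n → ℤ) (X : Matrix (Fin n) (Fin n) K) : Prop :=
  (∀ a, X a a = 1) ∧ ∀ a b, a ≠ b → X a b ≠ 0 → b < a ∧ u b < u a

lemma SuppR.one (u : Fin n → ℤ) : SuppR u (1 : Matrix (Fin n) (Fin n) K) := by
  refine ⟨fun a => by simp, fun a b hab h => ?_⟩
  simp [hab] at h

lemma SuppR.mul {u : Fin n → ℤ} {X Y : Matrix (Fin n) (Fin n) K} (hX : SuppR u X)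
    (hY : SuppR u Y) : SuppR u (X * Y) := by
  refine ⟨fun a => ?_, fun a b hab h => ?_⟩
  · rw [Matrix.mul_apply, Finset.sum_eq_single a, hX.1, hY.1, one_mul]
    · intro j _ hj
      by_contra hc
      have h1 := hX.2 a j (Ne.symm hj) (left_ne_zero_of_mul hc)
      have h2 := hY.2 j a hj (right_ne_zero_of_mul hc)
      exact absurd h1.1 (not_lt.mpr h2.1.le)
    · simp
  · rw [Matrix.mul_apply] at h
    obtain ⟨j, _, hj⟩ := Finset.exists_ne_zero_of_sum_ne_zero h
    have h1 := hX.2 a j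
    have h2 := hY.2 j b
    have h3 := left_ne_zero_of_mul hj
    have h4 := right_ne_zero_of_mul hj
    by_cases ja : a = j
    · subst ja; exact h2 hab h4
    · by_cases jb : j = b
      · subst jb; exact h1 hab h3
      · exact ⟨(h2 jb h4).1.trans (h1 ja h3).1, (h2 jb h4).2.trans (h1 ja h3).2⟩

lemma SuppR.xmatT {p q : Fin n} (h : (p : ℕ) + 1 = q) {u : Fin n → ℤ} (hu : u p < u q) (c : K) :
    SuppR u (xmat (q : ℕ) c : Matrix (Fin n) (Fin n) K)ᵀ := by
  have hlt : p < q := by rw [Fin.lt_def]; omega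
  refine ⟨fun a => ?_, fun a b hab hx => ?_⟩
  · have : ¬ (a = p ∧ a = q) := by
      rintro ⟨rfl, h2⟩; exact hlt.ne h2
    rw [Matrix.transpose_apply, xmat_apply h, if_neg this]
    simp
  · rw [Matrix.transpose_apply, xmat_apply h, if_neg (Ne.symm hab), zero_add] at hx
    by_cases hc : b = p ∧ a = q
    · rw [hc.1, hc.2]; exact ⟨hlt, hu⟩
    · rw [if_neg hc] at hx; exact absurd rfl hx

lemma SuppR.conj_aux {p q : Fin n} (h : (p : ℕ) + 1 = q) {u : Fin n → ℤ} (hu : u q < u p)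
    {X Y : Matrix (Fin n) (Fin n) K} (hX : SuppR u X) (e : Fin n → K) (he : ∀ a, e a * e a = 1)
    (hY : ∀ a b, Y a b = e a * X (Equiv.swap p q a) (Equiv.swap p q b) * e b) :
    SuppR (fun a => u (Equiv.swap p q a)) Y := by
  refine ⟨fun a => ?_, fun a b hab hx => ?_⟩
  · rw [hY, hX.1, mul_one, he]
  · rw [hY] at hx
    have h1 := right_ne_zero_of_mul (left_ne_zero_of_mul hx)
    have h2 := hX.2 _ _ (fun h => hab ((Equiv.swap p q).injective h)) h1
    refine ⟨?_, h2.2⟩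
    have := swap_lt h h2.1 ?_
    · simpa using this
    · rintro ⟨h3, h4⟩
      rw [h3, h4] at h2
      exact absurd h2.2 (not_lt.mpr hu.le)

lemma SuppR.conj {p q : Fin n} (h : (p : ℕ) + 1 = q) {u : Fin n → ℤ} (hu : u q < u p)
    {X : Matrix (Fin n) (Fin n) K} (hX : SuppR u X) :
    SuppR (fun a => u (Equiv.swap p q a)) (sdot (q : ℕ) * X * (sdot (q : ℕ))ᵀ) :=
  hX.conj_aux h hu (eps q) (eps_mul_self q) fun a b => by
    rw [mul_sdotT_apply h, sdot_mul_apply h]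

lemma SuppR.conj' {p q : Fin n} (h : (p : ℕ) + 1 = q) {u : Fin n → ℤ} (hu : u q < u p)
    {X : Matrix (Fin n) (Fin n) K} (hX : SuppR u X) :
    SuppR (fun a => u (Equiv.swap p q a)) ((sdot (q : ℕ))ᵀ * X * sdot (q : ℕ)) :=
  hX.conj_aux h hu (fun a => eps q (Equiv.swap p q a)) (fun a => eps_mul_self q _) fun a b => by
    rw [mul_sdot_apply h, sdotT_mul_apply h]

lemma SuppR.isNm {u : Fin n → ℤ} {X : Matrix (Fin n) (Fin n) K} (hX : SuppR u X) : IsNm X := by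
  refine ⟨hX.1, fun a b hab => ?_⟩
  by_contra hc
  exact absurd (hX.2 a b hab.ne hc).1 (not_lt.mpr hab.le)

lemma minor_eq (X : Matrix (Fin n) (Fin n) K) {I J : Finset (Fin n)} {k : ℕ} (hI : I.card = k)
    (hJ : J.card = k) :
    minor X I J = (X.submatrix (I.orderEmbOfFin hI) (J.orderEmbOfFin hJ)).det := by
  subst hI
  unfold minor
  rw [dif_pos hJ.symm]
  rfl

lemma minor_ne (X : Matrix (Fin n) (Fin n) K) {I J : Finset (Fin n)} (h : I.card ≠ J.card) :
    minor X I J = 0 := by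
  unfold minor
  rw [dif_neg h]

lemma minor_T (X : Matrix (Fin n) (Fin n) K) (I J : Finset (Fin n)) :
    minor Xᵀ I J = minor X J I := by
  by_cases h : I.card = J.card
  · rw [minor_eq Xᵀ h rfl, minor_eq X rfl h, ← Matrix.det_transpose]
    rfl
  · rw [minor_ne _ h, minor_ne _ (Ne.symm h)]

lemma sum_orderEmb (I : Finset (Fin n)) {k : ℕ} (hI : I.card = k) (f : Fin n → K) :
    ∑ c, f (I.orderEmbOfFin hI c) = ∑ x ∈ I, f x := by
  conv_rhs => rw [← Finset.map_orderEmbOfFin_univ I hI, Finset.sum_map]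
  rfl

lemma prod_orderEmb (I : Finset (Fin n)) {k : ℕ} (hI : I.card = k) (f : Fin n → K) :
    ∏ c, f (I.orderEmbOfFin hI c) = ∏ x ∈ I, f x := by
  conv_rhs => rw [← Finset.map_orderEmbOfFin_univ I hI, Finset.prod_map]
  rfl

lemma minor_lead (N P : Matrix (Fin n) (Fin n) K) (hN : IsNm N)
    (hP : ∀ a b : Fin n, b < a → P a b = 0) (I : Finset (Fin n))
    (hI : ∀ a ∈ I, ∀ b, b < a → b ∈ I) :
    minor (N * P) I I = ∏ x ∈ I, P x x := by
  rw [minor_eq _ rfl rfl]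
  set e := I.orderEmbOfFin rfl with he
  have h1 : (N * P).submatrix e e = N.submatrix e e * P.submatrix e e := by
    ext a b
    rw [Matrix.mul_apply]
    simp only [Matrix.submatrix_apply]
    rw [sum_orderEmb I rfl (fun j => N (e a) j * P j (e b)), Matrix.mul_apply]
    symm
    apply Finset.sum_subset (Finset.subset_univ _)
    intro j _ hj
    rw [hN.2, zero_mul]
    by_contra hc
    rcases lt_or_eq_of_le (not_lt.mp hc) with h | h
    · exact hj (hI _ (Finset.orderEmbOfFin_mem I rfl a) _ h)
    · exact hj (h ▸ Finset.orderEmbOfFin_mem I rfl a)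
  rw [h1, Matrix.det_mul, Matrix.det_of_isLowerTriangular, Matrix.det_of_isUpperTriangular]
  · simp only [Matrix.submatrix_apply, hN.1, Finset.prod_const_one, one_mul]
    exact prod_orderEmb I rfl (fun x => P x x)
  · intro a b hab
    exact hP _ _ (e.strictMono hab)
  · intro a b hab
    exact hN.2 _ _ (e.strictMono (by simpa using hab))

lemma image_swap_eq {p q : Fin n} (I : Finset (Fin n)) (h : p ∈ I ↔ q ∈ I) :
    I.image (Equiv.swap p q) = I := by
  apply Finset.eq_of_subset_of_card_le
  · intro x hx
    obtain ⟨y, hy, rfl⟩ := Finset.mem_image.mp hx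
    rw [Equiv.swap_apply_def]
    split_ifs with h1 h2
    · subst h1; exact h.mp hy
    · subst h2; exact h.mpr hy
    · exact hy
  · rw [Finset.card_image_of_injective _ (Equiv.injective _)]

lemma minor_sdot {p q : Fin n} (h : (p : ℕ) + 1 = q) (X : Matrix (Fin n) (Fin n) K)
    (I J : Finset (Fin n)) (hI : q ∈ I → p ∈ I) :
    minor (sdot (q : ℕ) * X) I J = minor X (I.image (Equiv.swap p q)) J := by
  have hne : p ≠ q := by rintro rfl; omega
  have hcard : (I.image (Equiv.swap p q)).card = I.card :=
    Finset.card_image_of_injective _ (Equiv.injective _)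
  by_cases hIJ : I.card = J.card
  swap
  · rw [minor_ne _ hIJ, minor_ne _ (by rwa [hcard])]
  by_cases hp : p ∈ I
  · by_cases hq : q ∈ I
    · rw [image_swap_eq I (by tauto), minor_eq _ hIJ rfl, minor_eq _ hIJ rfl]
      set e := I.orderEmbOfFin hIJ with he
      have hr : ∀ x ∈ I, ∃ a, e a = x := by
        intro x hx
        have : x ∈ Set.range e := by rw [he, Finset.range_orderEmbOfFin]; exact hx
        exact this
      obtain ⟨a0, ha0⟩ := hr p hp
      obtain ⟨b0, hb0⟩ := hr q hq
      have hne' : a0 ≠ b0 := by rintro rfl; exact hne (ha0.symm.trans hb0)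
      refine Eq.trans ?_ (det_sswap (K := K) a0 b0 hne' _)
      congr 1
      ext a b
      simp only [Matrix.submatrix_apply, Matrix.of_apply]
      rw [sdot_mul_apply h]
      congr 1
      · unfold eps
        rw [← hb0]
        simp
      · rw [← ha0, ← hb0, ← e.injective.map_swap]
    · have hmono : StrictMono (fun a => Equiv.swap p q (I.orderEmbOfFin hIJ a)) := by
        intro a b hab
        apply swap_lt h ((I.orderEmbOfFin hIJ).strictMono hab)
        rintro ⟨-, h2⟩
        exact hq (h2 ▸ Finset.orderEmbOfFin_mem I hIJ b)
      have hu := Finset.orderEmbOfFin_unique (hcard.trans hIJ) (f := fun a => Equiv.swap p q (I.orderEmbOfFin hIJ a))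
        (fun x => Finset.mem_image_of_mem _ (Finset.orderEmbOfFin_mem I hIJ x)) hmono
      rw [minor_eq _ hIJ rfl, minor_eq _ (hcard.trans hIJ) rfl]
      congr 1
      ext a b
      simp only [Matrix.submatrix_apply]
      rw [sdot_mul_apply h, ← hu]
      unfold eps
      rw [if_neg, one_mul]
      intro h2
      exact hq (h2 ▸ Finset.orderEmbOfFin_mem I hIJ a)
  · have hq : q ∉ I := fun hq => hp (hI hq)
    rw [image_swap_eq I (by tauto), minor_eq _ hIJ rfl, minor_eq _ hIJ rfl]
    congr 1
    ext a b
    simp only [Matrix.submatrix_apply]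
    have hm := Finset.orderEmbOfFin_mem I hIJ a
    rw [sdot_mul_apply h, Equiv.swap_apply_of_ne_of_ne]
    · unfold eps
      rw [if_neg, one_mul]
      intro h2; exact hq (h2 ▸ hm)
    · intro h2; exact hp (h2 ▸ hm)
    · intro h2; exact hq (h2 ▸ hm)

lemma down_ind {P : ℕ → Prop} {m : ℕ} (h0 : P m) (hs : ∀ r < m, P (r + 1) → P r) :
    ∀ r ≤ m, P r := by
  have : ∀ k r, r + k = m → P r := by
    intro k
    induction k with
    | zero => intro r hr; simp at hr; exact hr ▸ h0
    | succ k ih => intro r hr; exact hs r (by omega) (ih (r + 1) (by omega))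
  intro r hr
  exact this (m - r) r (by omega)

lemma conj_xmat {p q : Fin n} (h : (p : ℕ) + 1 = q) (c : K) :
    ((sdot (q : ℕ))ᵀ * xmat (q : ℕ) c * sdot (q : ℕ) : Matrix (Fin n) (Fin n) K)
      = (xmat (q : ℕ) (-c))ᵀ := by
  have hne : p ≠ q := by rintro rfl; omega
  ext a b
  rw [mul_sdot_apply h, sdotT_mul_apply h, Matrix.transpose_apply, xmat_apply h, xmat_apply h]
  simp only [EmbeddingLike.apply_eq_iff_eq]
  have e1 : Equiv.swap p q a = p ↔ a = q := by
    rw [Equiv.swap_apply_eq_iff, Equiv.swap_apply_left]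
  have e2 : Equiv.swap p q b = q ↔ b = p := by
    rw [Equiv.swap_apply_eq_iff, Equiv.swap_apply_right]
  have e3 : Equiv.swap p q a = q ↔ a = p := by
    rw [Equiv.swap_apply_eq_iff, Equiv.swap_apply_right]
  simp only [eps, e1, e2, e3]
  by_cases hab : a = b
  · subst hab
    by_cases h1 : a = p
    · subst h1; simp [hne]
    · simp [h1]
  · have hba : ¬ b = a := Ne.symm hab
    by_cases hc : a = q ∧ b = p
    · obtain ⟨rfl, rfl⟩ := hc
      simp [hne, hne.symm]
    · have hc' : ¬ (b = p ∧ a = q) := fun h => hc h.symm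
      simp [hab, hba, hc, hc']

section core

variable {p q : ℕ → Fin n} {J : ℕ → Prop} {u : ℕ → Equiv.Perm (Fin n)}

lemma supp_V (hpq : ∀ r < m, (p r : ℕ) + 1 = q r)
    (hu1 : ∀ r < m, J r → u (r + 1) = u r)
    (hu2 : ∀ r < m, ¬ J r → u (r + 1) = u r * Equiv.swap (p r) (q r))
    (hu3 : ∀ r < m, u r (p r) < u r (q r))
    (t : ℕ → K) (V G : ℕ → Matrix (Fin n) (Fin n) K)
    (hVm : V m = 1) (hV1 : ∀ r < m, J r → V r = V (r + 1))
    (hV2 : ∀ r < m, ¬ J r → V r = sdot (q r : ℕ) * V (r + 1))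
    (hGm : G m = 1) (hG1 : ∀ r < m, J r → G r = xmat (q r : ℕ) (t r) * G (r + 1))
    (hG2 : ∀ r < m, ¬ J r → G r = sdot (q r : ℕ) * G (r + 1)) :
    ∀ r ≤ m, SuppR (fun a => ((u r a : ℕ) : ℤ)) (V r * (G r)ᵀ) := by
  apply down_ind
  · rw [hVm, hGm]; simpa using SuppR.one _
  · intro r hr ih
    have h3 := hu3 r hr
    by_cases hJ : J r
    · rw [hV1 r hr hJ, hG1 r hr hJ, Matrix.transpose_mul, ← mul_assoc]
      rw [hu1 r hr hJ] at ih
      exact ih.mul (SuppR.xmatT (hpq r hr) (by simpa using h3) _)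
    · rw [hV2 r hr hJ, hG2 r hr hJ, Matrix.transpose_mul, mul_assoc, ← mul_assoc (V (r+1)),
        ← mul_assoc]
      have h4 := ih.conj (hpq r hr) (by rw [hu2 r hr hJ]; simpa using h3)
      rw [hu2 r hr hJ] at h4
      simpa using h4

lemma supp_U (hpq : ∀ r < m, (p r : ℕ) + 1 = q r)
    (hu2 : ∀ r < m, u (r + 1) = u r * Equiv.swap (p r) (q r))
    (hu3 : ∀ r < m, u r (p r) < u r (q r))
    (c : ℕ → K) (W Ki : ℕ → Matrix (Fin n) (Fin n) K)
    (hWm : W m = 1) (hW : ∀ r < m, W r = sdot (q r : ℕ) * W (r + 1))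
    (hKm : Ki m = 1)
    (hK : ∀ r < m, Ki r = xmat (q r : ℕ) (-c r) * sdot (q r : ℕ) * Ki (r + 1)) :
    ∀ r ≤ m, SuppR (fun a => ((u r a : ℕ) : ℤ)) (Ki r * (W r)ᵀ)ᵀ := by
  apply down_ind
  · rw [hWm, hKm]; simpa using SuppR.one _
  · intro r hr ih
    have h3 := hu3 r hr
    have h4 := ih.conj (hpq r hr) (by rw [hu2 r hr]; simpa using h3)
    rw [hu2 r hr] at h4
    have h5 := SuppR.mul (u := fun a => ((u r a : ℕ) : ℤ)) (by simpa using h4)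
      (SuppR.xmatT (hpq r hr) (by simpa using h3) (-c r))
    convert h5 using 1
    rw [hW r hr, hK r hr]
    simp only [Matrix.transpose_mul, Matrix.transpose_transpose, mul_assoc]

lemma exists_L (hpq : ∀ r < m, (p r : ℕ) + 1 = q r)
    (hu2 : ∀ r < m, u (r + 1) = u r * Equiv.swap (p r) (q r))
    (hu3 : ∀ r < m, u r (p r) < u r (q r))
    (c : ℕ → K) (W Ki : ℕ → Matrix (Fin n) (Fin n) K)
    (hWm : W m = 1) (hW : ∀ r < m, W r = sdot (q r : ℕ) * W (r + 1))
    (hKm : Ki m = 1)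
    (hK : ∀ r < m, Ki r = xmat (q r : ℕ) (-c r) * sdot (q r : ℕ) * Ki (r + 1)) :
    ∃ L, IsNm L ∧ Ki 0 * L = W 0 := by
  have key : ∀ r ≤ m, ∃ L : Matrix (Fin n) (Fin n) K,
      SuppR (fun a => -((u r a : ℕ) : ℤ)) L ∧ ∀ X, Ki r * X = L * W r → Ki 0 * X = W 0 := by
    intro r
    induction r with
    | zero =>
      intro _
      exact ⟨1, SuppR.one _, fun X hX => by rw [hX, one_mul]⟩
    | succ r ih =>
      intro hr
      obtain ⟨L, hL, hX⟩ := ih (by omega)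
      have hr' : r < m := hr
      have h3 := hu3 r hr'
      have h4 := hL.conj' (hpq r hr') (by simpa using h3)
      have h5 : SuppR (fun a => -((u (r+1) a : ℕ) : ℤ))
          ((sdot (q r : ℕ))ᵀ * xmat (q r : ℕ) (c r) * sdot (q r : ℕ) : Matrix (Fin n) (Fin n) K) := by
        have hh := SuppR.xmatT (hpq r hr') (u := fun a => -((u (r+1) a : ℕ) : ℤ))
          (by rw [hu2 r hr']; simpa using h3) (-c r)
        convert hh using 1
        exact conj_xmat (hpq r hr') _
      refine ⟨(sdot (q r : ℕ))ᵀ * xmat (q r : ℕ) (c r) * L * sdot (q r : ℕ), ?_, ?_⟩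
      · rw [hu2 r hr'] at h5 ⊢
        have h6 := h5.mul (by simpa using h4)
        convert h6 using 1
        have := sdot_mul_sdotT (K := K) (hpq r hr')
        simp only [mul_assoc]
        rw [← mul_assoc (sdot (q r : ℕ)) (sdot (q r : ℕ))ᵀ, this, one_mul]
      · intro X h
        apply hX
        rw [hK r hr', mul_assoc, h, hW r hr']
        have h7 := sdot_mul_sdotT (K := K) (hpq r hr')
        have h8 := xmat_mul_neg (hpq r hr') (c r)
        calc _ = xmat (q r : ℕ) (-c r) * (sdot (q r : ℕ) * (sdot (q r : ℕ))ᵀ) * xmat (q r : ℕ) (c r)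
              * L * sdot (q r : ℕ) * W (r + 1) := by simp only [mul_assoc]
          _ = _ := by rw [h7, mul_one, h8, one_mul]; simp only [mul_assoc]
  obtain ⟨L, hL, hX⟩ := key m le_rfl
  exact ⟨L, hL.isNm, hX L (by rw [hKm, hWm, one_mul, mul_one])⟩

lemma minor_V (hpq : ∀ r < m, (p r : ℕ) + 1 = q r)
    (hu1 : ∀ r < m, J r → u (r + 1) = u r)
    (hu2 : ∀ r < m, ¬ J r → u (r + 1) = u r * Equiv.swap (p r) (q r))
    (hu3 : ∀ r < m, u r (p r) < u r (q r))
    (V : ℕ → Matrix (Fin n) (Fin n) K)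
    (hVm : V m = 1) (hV1 : ∀ r < m, J r → V r = V (r + 1))
    (hV2 : ∀ r < m, ¬ J r → V r = sdot (q r : ℕ) * V (r + 1))
    (A : ℕ → Equiv.Perm (Fin n))
    (hAm : A m = 1) (hA1 : ∀ r < m, J r → A r = A (r + 1))
    (hA2 : ∀ r < m, ¬ J r → A r = A (r + 1) * Equiv.swap (p r) (q r))
    (X : Matrix (Fin n) (Fin n) K) (I' : Finset (Fin n)) :
    ∀ r ≤ m, ∀ I : Finset (Fin n), (∀ a ∈ I, ∀ b ∉ I, b < a → u r a < u r b) →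
      minor (V r * X) I I' = minor X (I.image (A r)) I' := by
  apply down_ind
  · intro I _
    rw [hVm, hAm, one_mul]
    congr 1
    ext; simp
  · intro r hr ih I hI
    have h3 := hu3 r hr
    by_cases hJ : J r
    · rw [hV1 r hr hJ, hA1 r hr hJ]
      apply ih
      rw [hu1 r hr hJ]
      exact hI
    · have hlt : p r < q r := by rw [Fin.lt_def]; have := hpq r hr; omega
      rw [hV2 r hr hJ, mul_assoc, minor_sdot (hpq r hr), ih, hA2 r hr hJ, Finset.image_image]
      · rfl
      · intro a ha b hb hba
        rw [hu2 r hr hJ]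
        simp only [Equiv.Perm.mul_apply]
        have ha' : Equiv.swap (p r) (q r) a ∈ I := by
          obtain ⟨y, hy, rfl⟩ := Finset.mem_image.mp ha
          simpa using hy
        have hb' : Equiv.swap (p r) (q r) b ∉ I := by
          intro h
          apply hb
          exact Finset.mem_image.mpr ⟨_, h, by simp⟩
        by_cases hc : b = p r ∧ a = q r
        · rw [hc.1, hc.2]; simpa using h3
        · exact hI _ ha' _ hb' (swap_lt (hpq r hr) hba hc)
      · intro hq
        by_contra hp
        exact absurd (hI _ hq _ hp hlt) (not_lt.mpr h3.le)

lemma W_orth (hpq : ∀ r < m, (p r : ℕ) + 1 = q r)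
    (W : ℕ → Matrix (Fin n) (Fin n) K)
    (hWm : W m = 1) (hW : ∀ r < m, W r = sdot (q r : ℕ) * W (r + 1))
    (B : ℕ → Equiv.Perm (Fin n))
    (hBm : B m = 1) (hB : ∀ r < m, B r = B (r + 1) * Equiv.swap (p r) (q r)) (d : Fin n → K) :
    ∀ r ≤ m, W r * Matrix.diagonal d = Matrix.diagonal (fun x => d (B r x)) * W r := by
  apply down_ind
  · rw [hWm, hBm]; simp
  · intro r hr ih
    rw [hW r hr, mul_assoc, ih, ← mul_assoc, ← mul_assoc]
    congr 1
    ext a b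
    rw [sdot_mul_apply (hpq r hr), Matrix.diagonal_mul, sdot_apply (hpq r hr), hB r hr,
      Matrix.diagonal_apply]
    by_cases h : b = Equiv.swap (p r) (q r) a
    · rw [if_pos h, if_pos h.symm, mul_comm]; rfl
    · rw [if_neg h, if_neg (Ne.symm h)]; simp

end core

def UpG (Q : Matrix (Fin n) (Fin n) K) : Prop :=
  (∀ a b : Fin n, b < a → Q a b = 0) ∧ ∀ a, Q a a ≠ 0

lemma step_notJ {p q : Fin n} (h : (p : ℕ) + 1 = q) (Q : Matrix (Fin n) (Fin n) K) (hQ : UpG Q) :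
    ∃ c : K, UpG ((sdot (q : ℕ))ᵀ * Q * xmat (q : ℕ) (-c) * sdot (q : ℕ)) := by
  have hlt : p < q := by rw [Fin.lt_def]; omega
  refine ⟨Q p q / Q p p, ?_⟩
  set c := Q p q / Q p p with hc
  have key : ∀ a b, ((sdot (q : ℕ))ᵀ * Q * xmat (q : ℕ) (-c) * sdot (q : ℕ) : Matrix (Fin n) (Fin n) K) a b
      = eps q (Equiv.swap p q a) * (Q (Equiv.swap p q a) (Equiv.swap p q b) +
        if Equiv.swap p q b = q then Q (Equiv.swap p q a) p * (-c) else 0)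
        * eps q (Equiv.swap p q b) := by
    intro a b
    rw [mul_assoc (sdot (q : ℕ))ᵀ, mul_sdot_apply h, sdotT_mul_apply h, mul_xmat_apply h]
  constructor
  · intro a b hab
    rw [key]
    suffices hs : (Q (Equiv.swap p q a) (Equiv.swap p q b) +
        if Equiv.swap p q b = q then Q (Equiv.swap p q a) p * (-c) else 0) = 0 by
      rw [hs]; simp
    by_cases hh : b = p ∧ a = q
    · rw [hh.1, hh.2]
      simp only [Equiv.swap_apply_left, Equiv.swap_apply_right, if_true]
      have := hQ.2 p
      rw [hc]; field_simp; ring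
    · have h1 := swap_lt h hab hh
      rw [hQ.1 _ _ h1, zero_add]
      split_ifs with h2
      · rw [h2] at h1
        rw [hQ.1 _ _ (hlt.trans h1), zero_mul]
      · rfl
  · intro a
    rw [key]
    refine mul_ne_zero (mul_ne_zero (eps_ne _ _) ?_) (eps_ne _ _)
    split_ifs with h2
    · rw [h2, hQ.1 q p hlt]; simpa using hQ.2 q
    · simpa using hQ.2 _

lemma step_J {p q : Fin n} (h : (p : ℕ) + 1 = q) (Q : Matrix (Fin n) (Fin n) K) (hQ : UpG Q)
    (t : K) (ht : t ≠ 0) :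
    ∃ c : K, UpG ((xmat (q : ℕ) t)ᵀ * Q * xmat (q : ℕ) (-c) * sdot (q : ℕ)) ∧
      ∀ a, ((xmat (q : ℕ) t)ᵀ * Q * xmat (q : ℕ) (-c) * sdot (q : ℕ) : Matrix (Fin n) (Fin n) K) a a
        = (if a = p then t⁻¹ else if a = q then t else 1)
          * Q (Equiv.swap p q a) (Equiv.swap p q a) := by
  have hlt : p < q := by rw [Fin.lt_def]; omega
  refine ⟨(Q p q + Q q q / t) / Q p p, ?_⟩
  set c := (Q p q + Q q q / t) / Q p p with hc
  have hp := hQ.2 p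
  have hcp : c * Q p p = Q p q + Q q q / t := by rw [hc]; field_simp
  have key : ∀ a b, ((xmat (q : ℕ) t)ᵀ * Q * xmat (q : ℕ) (-c) * sdot (q : ℕ) : Matrix (Fin n) (Fin n) K) a b
      = ((Q a (Equiv.swap p q b) + if a = q then t * Q p (Equiv.swap p q b) else 0) +
        if Equiv.swap p q b = q then (Q a p + if a = q then t * Q p p else 0) * (-c) else 0)
        * eps q (Equiv.swap p q b) := by
    intro a b
    have : ∀ a b, ((xmat (q : ℕ) t)ᵀ * Q : Matrix (Fin n) (Fin n) K) a b
        = Q a b + if a = q then t * Q p b else 0 := by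
      intro a b
      have := mul_xmat_apply h t Qᵀ b a
      rw [← Matrix.transpose_apply (Qᵀ * _), Matrix.transpose_mul, Matrix.transpose_transpose] at this
      rw [this]
      simp [mul_comm]
    rw [mul_sdot_apply h, mul_xmat_apply h, this, this]
  have hdiag : ∀ a, ((xmat (q : ℕ) t)ᵀ * Q * xmat (q : ℕ) (-c) * sdot (q : ℕ) : Matrix (Fin n) (Fin n) K) a a
        = (if a = p then t⁻¹ else if a = q then t else 1)
          * Q (Equiv.swap p q a) (Equiv.swap p q a) := by
    intro a
    rw [key]
    unfold eps
    by_cases h1 : a = p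
    · subst h1
      simp only [Equiv.swap_apply_left, if_true, if_neg hlt.ne]
      linear_combination hcp
    · by_cases h2 : a = q
      · subst h2
        simp only [Equiv.swap_apply_right, if_true, if_neg hlt.ne, if_neg h1, hQ.1 _ _ hlt]
        ring
      · simp [Equiv.swap_apply_of_ne_of_ne h1 h2, h1, h2]
  refine ⟨⟨?_, ?_⟩, hdiag⟩
  · intro a b hab
    rw [key]
    apply mul_eq_zero_of_left
    by_cases h1 : b = p
    · subst h1
      simp only [Equiv.swap_apply_left, if_true]
      by_cases h2 : a = q
      · subst h2
        simp only [if_true, hQ.1 _ _ hlt]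
        have : t * (Q a a / t) = Q a a := by field_simp
        linear_combination (-t) * hcp - this
      · have h3 : q < a := by
          rw [Fin.lt_def] at *
          have : (a : ℕ) ≠ q := fun h => h2 (Fin.ext h)
          omega
        simp [h2, hQ.1 _ _ h3, hQ.1 _ _ hab]
    · by_cases h2 : b = q
      · subst h2
        simp only [Equiv.swap_apply_right, if_neg hlt.ne, if_neg hab.ne', hQ.1 _ _ (hlt.trans hab)]
        simp
      · rw [Equiv.swap_apply_of_ne_of_ne h1 h2, if_neg h2, hQ.1 _ _ hab]
        split_ifs with h3
        · subst h3
          have : b < p := by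
            rw [Fin.lt_def] at *
            have : (b : ℕ) ≠ p := fun h => h1 (Fin.ext h)
            omega
          rw [hQ.1 _ _ this]; simp
        · simp
  · intro a
    rw [hdiag]
    refine mul_ne_zero ?_ (hQ.2 _)
    split_ifs <;> simp [ht]

lemma UDL_unique (a b c P L : Matrix (Fin n) (Fin n) K) (ha : IsN a) (hb : IsH b) (hc : IsNm c)
    (hP : UpG P) (hL : IsNm L) (h : a * b * c = P * L) : a * b = P := by
  have hdP : IsUnit P.det := by
    rw [Matrix.det_of_isUpperTriangular (fun i j hij => hP.1 i j hij)]
    exact (Finset.prod_ne_zero_iff.mpr fun i _ => hP.2 i).isUnit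
  have hdc : c.det = 1 := by
    rw [Matrix.det_of_isLowerTriangular _ (fun i j hij => hc.2 i j (by simpa using hij))]
    simp [hc.1]
  have hdc' : IsUnit c.det := by rw [hdc]; exact isUnit_one
  let _ := Matrix.invertibleOfIsUnitDet P hdP
  let _ := Matrix.invertibleOfIsUnitDet c hdc'
  have hX : P⁻¹ * (a * b) = L * c⁻¹ := by
    rw [← Matrix.mul_nonsing_inv_cancel_right c (a * b) hdc', h, mul_assoc, 
      Matrix.nonsing_inv_mul_cancel_left _ _ hdP]
  have hab : Matrix.BlockTriangular (a * b) id := by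
    apply Matrix.BlockTriangular.mul
    · intro i j hij; exact ha.2 i j hij
    · intro i j hij; exact hb.2 i j (ne_of_gt hij)
  have hPt : Matrix.BlockTriangular P id := fun i j hij => hP.1 i j hij
  have h1 : Matrix.BlockTriangular (P⁻¹ * (a * b)) id :=
    (Matrix.blockTriangular_inv_of_blockTriangular hPt).mul hab
  have hct : Matrix.BlockTriangular c OrderDual.toDual := fun i j hij => hc.2 i j (by simpa using hij)
  have hLt : Matrix.BlockTriangular L OrderDual.toDual := fun i j hij => hL.2 i j (by simpa using hij)
  have h2 : Matrix.BlockTriangular (L * c⁻¹) OrderDual.toDual :=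
    hLt.mul (Matrix.blockTriangular_inv_of_blockTriangular hct)
  rw [← hX] at h2
  have hXc : P⁻¹ * (a * b) * c = L := by
    rw [hX, Matrix.nonsing_inv_mul_cancel_right _ _ hdc']
  have hX1 : P⁻¹ * (a * b) = 1 := by
    have off : ∀ i j, i ≠ j → (P⁻¹ * (a * b)) i j = 0 := by
      intro i j hij
      rcases lt_or_gt_of_ne hij with h | h
      · exact h2 (by simpa using h)
      · exact h1 h
    ext i j
    by_cases hij : i = j
    · subst hij
      have := congrFun (congrFun hXc i) i
      rw [hL.1, Matrix.mul_apply, Finset.sum_eq_single i, hc.1, mul_one] at this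
      · rw [this]; simp
      · intro k _ hk; rw [off i k hk.symm, zero_mul]
      · simp
    · rw [off i j hij, Matrix.one_apply_ne hij]
  rw [← Matrix.mul_nonsing_inv_cancel_left P (a * b) hdP, hX1, mul_one]

lemma drop_ofFn_nil {M : Type*} (f : Fin m → M) : (List.ofFn f).drop m = [] :=
  List.drop_eq_nil_of_le (by simp)

lemma exists_tail {M : Type*} [Monoid M] (f : ℕ → M) (m : ℕ) :
    ∃ V : ℕ → M, V m = 1 ∧ ∀ r < m, V r = f r * V (r + 1) := by
  refine ⟨fun r => ((List.range' r (m - r)).map f).prod, by simp, fun r hr => ?_⟩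
  have : m - r = (m - (r + 1)) + 1 := by omega
  simp only
  rw [this, List.range'_succ, List.map_cons, List.prod_cons]

theorem core {p q : ℕ → Fin n} {J : ℕ → Prop} {u w : ℕ → Equiv.Perm (Fin n)}
    (hpq : ∀ r < m, (p r : ℕ) + 1 = q r)
    (hu1 : ∀ r < m, J r → u (r + 1) = u r)
    (hu2 : ∀ r < m, ¬ J r → u (r + 1) = u r * Equiv.swap (p r) (q r))
    (hu3 : ∀ r < m, u r (p r) < u r (q r))
    (hw2 : ∀ r < m, w (r + 1) = w r * Equiv.swap (p r) (q r))
    (hw3 : ∀ r < m, w r (p r) < w r (q r))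
    (t : ℕ → K) (ht : ∀ r < m, J r → t r ≠ 0) (G W : ℕ → Matrix (Fin n) (Fin n) K)
    (hGm : G m = 1) (hG1 : ∀ r < m, J r → G r = xmat (q r : ℕ) (t r) * G (r + 1))
    (hG2 : ∀ r < m, ¬ J r → G r = sdot (q r : ℕ) * G (r + 1))
    (hWm : W m = 1) (hW : ∀ r < m, W r = sdot (q r : ℕ) * W (r + 1))
    (A B : ℕ → Equiv.Perm (Fin n))
    (hAm : A m = 1) (hA1 : ∀ r < m, J r → A r = A (r + 1))
    (hA2 : ∀ r < m, ¬ J r → A r = A (r + 1) * Equiv.swap (p r) (q r))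
    (hBm : B m = 1) (hB : ∀ r < m, B r = B (r + 1) * Equiv.swap (p r) (q r)) :
    (∃ a b c, UDL ((G 0)ᵀ * W 0) a b c) ∧
    ∀ a b c, UDL ((G 0)ᵀ * W 0) a b c → ∃ f : ℕ → Fin n → K,
      (∀ r ≤ m, ∀ I : Finset (Fin n), (∀ a ∈ I, ∀ b, b < a → b ∈ I) →
        minor a (I.image (A r)) (I.image (B r)) = ∏ x ∈ I, f r x) ∧
      ∀ r < m, J r → ∀ x, f (r + 1) x
        = (if x = p r then (t r)⁻¹ else if x = q r then t r else 1)
          * f r (Equiv.swap (p r) (q r) x) := by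
  -- the sequence P
  have step : ∀ (r : ℕ) (Q : Matrix (Fin n) (Fin n) K), ∃ c : K, r < m → UpG Q →
      (J r → UpG ((xmat (q r : ℕ) (t r))ᵀ * Q * xmat (q r : ℕ) (-c) * sdot (q r : ℕ)) ∧
      ∀ a, ((xmat (q r : ℕ) (t r))ᵀ * Q * xmat (q r : ℕ) (-c) * sdot (q r : ℕ) :
          Matrix (Fin n) (Fin n) K) a a
        = (if a = p r then (t r)⁻¹ else if a = q r then t r else 1)
          * Q (Equiv.swap (p r) (q r) a) (Equiv.swap (p r) (q r) a)) ∧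
      (¬ J r → UpG ((sdot (q r : ℕ))ᵀ * Q * xmat (q r : ℕ) (-c) * sdot (q r : ℕ))) := by
    intro r Q
    by_cases hr : r < m
    · by_cases hQ : UpG Q
      · by_cases hJ : J r
        · obtain ⟨c, hc⟩ := step_J (hpq r hr) Q hQ (t r) (ht r hr hJ)
          exact ⟨c, fun _ _ => ⟨fun _ => hc, fun h => absurd hJ h⟩⟩
        · obtain ⟨c, hc⟩ := step_notJ (hpq r hr) Q hQ
          exact ⟨c, fun _ _ => ⟨fun h => absurd h hJ, fun _ => hc⟩⟩
      · exact ⟨0, fun _ h => absurd h hQ⟩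
    · exact ⟨0, fun h => absurd h hr⟩
  choose C hC using step
  let g : ℕ → Matrix (Fin n) (Fin n) K := fun r => if J r then xmat (q r : ℕ) (t r) else sdot (q r : ℕ)
  let P : ℕ → Matrix (Fin n) (Fin n) K := fun r => Nat.rec 1
    (fun r Q => (g r)ᵀ * Q * xmat (q r : ℕ) (-(C r Q)) * sdot (q r : ℕ)) r
  have hP0 : P 0 = 1 := rfl
  let c : ℕ → K := fun r => C r (P r)
  have hPs : ∀ r, P (r + 1) = (g r)ᵀ * P r * xmat (q r : ℕ) (-(c r)) * sdot (q r : ℕ) := fun r => rfl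
  have hPup : ∀ r ≤ m, UpG (P r) := by
    intro r
    induction r with
    | zero =>
      intro _
      rw [hP0]
      exact ⟨fun a b hab => Matrix.one_apply_ne (ne_of_gt hab), fun a => by simp⟩
    | succ r ih =>
      intro hr
      have h := hC r (P r) hr (ih (by omega))
      rw [hPs]
      by_cases hJ : J r
      · simp only [g, if_pos hJ]; exact (h.1 hJ).1
      · simp only [g, if_neg hJ]; exact h.2 hJ
  have hPd : ∀ r < m, J r → ∀ x, P (r + 1) x x
      = (if x = p r then (t r)⁻¹ else if x = q r then t r else 1)
          * P r (Equiv.swap (p r) (q r) x) (Equiv.swap (p r) (q r) x) := by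
    intro r hr hJ x
    have h := hC r (P r) hr (hPup r hr.le)
    rw [hPs]
    simp only [g, if_pos hJ]
    exact (h.1 hJ).2 x
  have hG : ∀ r < m, G r = g r * G (r + 1) := by
    intro r hr
    by_cases hJ : J r
    · simp only [g, if_pos hJ]; exact hG1 r hr hJ
    · simp only [g, if_neg hJ]; exact hG2 r hr hJ
  obtain ⟨V, hVm, hV⟩ := exists_tail
    (fun r => if J r then (1 : Matrix (Fin n) (Fin n) K) else sdot (q r : ℕ)) m
  have hV1 : ∀ r < m, J r → V r = V (r + 1) := by
    intro r hr hJ; rw [hV r hr]; simp [hJ]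
  have hV2 : ∀ r < m, ¬ J r → V r = sdot (q r : ℕ) * V (r + 1) := by
    intro r hr hJ; rw [hV r hr]; simp [hJ]
  obtain ⟨Ki, hKm, hK⟩ := exists_tail
    (fun r => (xmat (q r : ℕ) (-c r) * sdot (q r : ℕ) : Matrix (Fin n) (Fin n) K)) m
  have hPG : ∀ r ≤ m, P m = (G r)ᵀ * P r * Ki r := by
    apply down_ind
    · rw [hGm, hKm]; simp
    · intro r hr ih
      rw [ih, hPs, hG r hr, hK r hr]
      simp only [Matrix.transpose_mul, mul_assoc]
  obtain ⟨L, hL, hKL⟩ := exists_L hpq hw2 hw3 c W Ki hWm hW hKm hK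
  have hM : (G 0)ᵀ * W 0 = P m * L := by
    rw [hPG 0 (Nat.zero_le _), hP0, mul_one, mul_assoc, hKL]
  have hPm := hPup m le_rfl
  have hdetG : ∀ r ≤ m, (G r).det = 1 := by
    apply down_ind
    · rw [hGm]; simp
    · intro r hr ih
      rw [hG r hr, Matrix.det_mul, ih, mul_one]
      by_cases hJ : J r
      · simp only [g, if_pos hJ]; exact det_xmat (hpq r hr) _
      · simp only [g, if_neg hJ]; exact det_sdot (hpq r hr)
  have hdetW : ∀ r ≤ m, (W r).det = 1 := by
    apply down_ind
    · rw [hWm]; simp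
    · intro r hr ih
      rw [hW r hr, Matrix.det_mul, ih, mul_one]
      exact det_sdot (hpq r hr)
  constructor
  · have hdP : (P m).det = 1 := by
      have h1 := congrArg Matrix.det hM
      have h2 : L.det = 1 := by
        rw [Matrix.det_of_isLowerTriangular _ (fun i j hij => hL.2 i j (by simpa using hij))]
        simp [hL.1]
      rw [Matrix.det_mul, Matrix.det_mul, Matrix.det_transpose, hdetG 0 (Nat.zero_le _),
        hdetW 0 (Nat.zero_le _), h2] at h1
      simpa using h1.symm
    refine ⟨P m * Matrix.diagonal (fun x => (P m x x)⁻¹), Matrix.diagonal (fun x => P m x x), L,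
      ⟨fun i => ?_, fun i j hij => ?_⟩, ⟨?_, fun i j hij => Matrix.diagonal_apply_ne _ hij⟩, hL, ?_⟩
    · rw [Matrix.mul_diagonal]; exact mul_inv_cancel₀ (hPm.2 i)
    · rw [Matrix.mul_diagonal, hPm.1 i j hij, zero_mul]
    · rw [Matrix.det_diagonal, ← hdP, Matrix.det_of_isUpperTriangular (fun i j hij => hPm.1 i j hij)]
    · rw [hM, mul_assoc (P m), Matrix.diagonal_mul_diagonal]
      have : (fun x => (P m x x)⁻¹ * P m x x) = fun _ => (1 : K) := by
        ext x; exact inv_mul_cancel₀ (hPm.2 x)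
      rw [this, Matrix.diagonal_one, mul_one]
  · rintro a b d ⟨ha, hb, hd, hU⟩
    have hab : a * b = P m := UDL_unique a b d (P m) L ha hb hd hPm hL (by rw [← hU, hM])
    have hbd : b = Matrix.diagonal (fun x => b x x) := by
      ext i j
      by_cases hij : i = j
      · subst hij; simp
      · rw [hb.2 i j hij, Matrix.diagonal_apply_ne _ hij]
    have hb0 : ∀ x, b x x ≠ 0 := by
      intro x hx
      have := hb.1
      have h0 : ∏ i, b i i = 0 := Finset.prod_eq_zero (i := x) (Finset.mem_univ x) hx
      rw [hbd, Matrix.det_diagonal] at this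
      exact zero_ne_one (h0.symm.trans this)
    have haP : a = P m * Matrix.diagonal (fun x => (b x x)⁻¹) := by
      rw [← hab, mul_assoc]
      conv_rhs => rw [hbd]
      simp only [Matrix.diagonal_apply_eq]
      rw [Matrix.diagonal_mul_diagonal]
      have : (fun x => b x x * (b x x)⁻¹) = fun _ => (1 : K) := by
        ext x; exact mul_inv_cancel₀ (hb0 x)
      rw [this, Matrix.diagonal_one, mul_one]
    refine ⟨fun r x => P r x x * (b (B r x) (B r x))⁻¹, ?_, ?_⟩
    · intro r hr I hI
      have hgood : ∀ (z : Equiv.Perm (Fin n)), ∀ x ∈ I, ∀ y ∉ I, y < x → z x < z y :=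
        fun z x hx y hy hyx => absurd (hI x hx y hyx) hy
      have e1 := minor_V hpq hu1 hu2 hu3 V hVm hV1 hV2 A hAm hA1 hA2 a (I.image (B r)) r hr I
        (hgood _)
      have e2 := minor_V (J := fun _ => False) hpq (fun _ _ h => h.elim) (fun r hr _ => hw2 r hr) hw3
        W hWm (fun _ _ h => h.elim) (fun r hr _ => hW r hr) B hBm (fun _ _ h => h.elim)
        (fun r hr _ => hB r hr) (V r * a)ᵀ I r hr I (hgood _)
      rw [← e1, ← minor_T, ← e2, ← minor_T, Matrix.transpose_mul, Matrix.transpose_transpose]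
      have hN := (supp_V hpq hu1 hu2 hu3 t V G hVm hV1 hV2 hGm hG1 hG2 r hr).isNm
      have hUi := (supp_U hpq hw2 hw3 c W Ki hWm hW hKm hK r hr).isNm
      have hWd := W_orth hpq W hWm hW B hBm hB (fun x => (b x x)⁻¹) r hr
      have hWd' := congrArg Matrix.transpose hWd
      rw [Matrix.transpose_mul, Matrix.transpose_mul, Matrix.diagonal_transpose,
        Matrix.diagonal_transpose] at hWd'
      have hfin : V r * a * (W r)ᵀ = (V r * (G r)ᵀ) * (P r * (Ki r * (W r)ᵀ) *
          Matrix.diagonal (fun x => (b (B r x) (B r x))⁻¹)) := by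
        rw [haP, hPG r hr]
        simp only [mul_assoc]
        rw [hWd']
      rw [hfin, minor_lead _ _ hN _ I hI]
      · apply Finset.prod_congr rfl
        intro x _
        rw [Matrix.mul_diagonal, Matrix.mul_apply, Finset.sum_eq_single x]
        · have := hUi.1 x
          rw [Matrix.transpose_apply] at this
          rw [this, mul_one]
        · intro y _ hy
          rcases lt_or_gt_of_ne hy with h | h
          · rw [(hPup r hr).1 x y h, zero_mul]
          · have := hUi.2 x y h
            rw [Matrix.transpose_apply] at this
            rw [this, mul_zero]
        · simp
      · intro x y hxy
        rw [Matrix.mul_diagonal, Matrix.mul_apply, Finset.sum_eq_zero, zero_mul]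
        intro z _
        rcases lt_or_ge z x with h | h
        · rw [(hPup r hr).1 x z h, zero_mul]
        · have := hUi.2 y z (hxy.trans_le h)
          rw [Matrix.transpose_apply] at this
          rw [this, mul_zero]
    · intro r hr hJ x
      simp only
      rw [hPd r hr hJ, hB r hr]
      simp [mul_assoc]

lemma drop_prod {M : Type*} [Monoid M] (f : Fin m → M) (r : ℕ) (hr : r < m) :
    ((List.ofFn f).drop r).prod = f ⟨r, hr⟩ * ((List.ofFn f).drop (r + 1)).prod := by
  rw [List.drop_eq_getElem_cons (by simpa using hr)]
  simp

lemma drop_prod_rev {M : Type*} [Monoid M] (f : Fin m → M) (r : ℕ) (hr : r < m) :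
    ((List.ofFn f).drop r).reverse.prod = ((List.ofFn f).drop (r + 1)).reverse.prod * f ⟨r, hr⟩ := by
  rw [List.drop_eq_getElem_cons (by simpa using hr)]
  simp

lemma take_prod {M : Type*} [Monoid M] (f : Fin m → M) (r : ℕ) (hr : r < m) :
    ((List.ofFn f).take (r + 1)).prod = ((List.ofFn f).take r).prod * f ⟨r, hr⟩ := by
  rw [List.prod_take_succ _ _ (by simpa using hr)]
  simp

lemma len_one : len (1 : Equiv.Perm (Fin n)) = 0 := by
  unfold len
  rw [Finset.card_eq_zero, Finset.filter_eq_empty_iff]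
  rintro ⟨x, y⟩ - ⟨h1, h2⟩
  exact absurd h1 (not_lt.mpr (le_of_lt h2))

/-- right twist Chamber Ansatz (Theorem 2.12, eq. (2.12), type A),
written in the denominator-free form
`t_r · Δ^{A_r(i_r)}_{B_r(i_r)}(y⃗) · Δ^{A'_r}_{B'_r}(y⃗)
  = Δ^{A_r(i_r−1)}_{B_r(i_r−1)}(y⃗) · Δ^{A_r(i_r+1)}_{B_r(i_r+1)}(y⃗)`. -/
theorem statement_17 {n m : ℕ} (hn : 1 ≤ n) (ii : Fin m → ℕ)
    (hii : ∀ r, 1 ≤ ii r ∧ ii r < n)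
    (w : Equiv.Perm (Fin n)) (hw : w = (sPermList n ii).prod) (hred : len w = m)
    (v : Equiv.Perm (Fin n)) (hv0 : vseq ii v m = 1)
    (t : Fin m → ℂ) (ht : ∀ r, inJ ii v r → t r ≠ 0) :
    (∃ a b c, UDL ((mrg ii v t)ᵀ * wMR n ii) a b c) ∧
    ∀ a b c, UDL ((mrg ii v t)ᵀ * wMR n ii) a b c →
      ∀ r : Fin m, inJ ii v r →
        let σv := ((svPermList ii v).drop ((r : ℕ) + 1)).reverse.prod
        let σw := ((sPermList n ii).drop ((r : ℕ) + 1)).reverse.prod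
        let τv := ((svPermList ii v).drop (r : ℕ)).reverse.prod
        let τw := ((sPermList n ii).drop (r : ℕ)).reverse.prod
        t r *
          minor a ((univ.filter fun x : Fin n => (x : ℕ) < ii r).image ⇑σv)
                  ((univ.filter fun x : Fin n => (x : ℕ) < ii r).image ⇑σw) *
          minor a ((univ.filter fun x : Fin n => (x : ℕ) < ii r).image ⇑τv)
                  ((univ.filter fun x : Fin n => (x : ℕ) < ii r).image ⇑τw)
        =
        minor a ((univ.filter fun x : Fin n => (x : ℕ) < ii r - 1).image ⇑σv)
                ((univ.filter fun x : Fin n => (x : ℕ) < ii r - 1).image ⇑σw) *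
          minor a ((univ.filter fun x : Fin n => (x : ℕ) < ii r + 1).image ⇑σv)
                  ((univ.filter fun x : Fin n => (x : ℕ) < ii r + 1).image ⇑σw) := by
  set pf : Fin m → Fin n := fun r => ⟨ii r - 1, by have := hii r; omega⟩ with hpf
  set qf : Fin m → Fin n := fun r => ⟨ii r, (hii r).2⟩ with hqf
  have hs : ∀ r, sperm n (ii r) = Equiv.swap (pf r) (qf r) := by
    intro r
    unfold sperm
    rw [dif_pos (hii r).2]
  let p : ℕ → Fin n := fun r => if h : r < m then pf ⟨r, h⟩ else ⟨0, hn⟩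
  let q : ℕ → Fin n := fun r => if h : r < m then qf ⟨r, h⟩ else ⟨0, hn⟩
  have hp : ∀ r (h : r < m), p r = pf ⟨r, h⟩ := fun r h => dif_pos h
  have hq : ∀ r (h : r < m), q r = qf ⟨r, h⟩ := fun r h => dif_pos h
  have hqi : ∀ r (h : r < m), (q r : ℕ) = ii ⟨r, h⟩ := fun r h => by rw [hq r h]
  have hsp : ∀ r (h : r < m), sperm n (ii ⟨r, h⟩) = Equiv.swap (p r) (q r) := fun r h => by
    rw [hs, hp r h, hq r h]
  let J : ℕ → Prop := fun r => ∃ h : r < m, inJ ii v ⟨r, h⟩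
  have hJ : ∀ r (h : r < m), J r ↔ inJ ii v ⟨r, h⟩ := fun r h => ⟨fun ⟨_, h'⟩ => h', fun h' => ⟨h, h'⟩⟩
  let t' : ℕ → ℂ := fun r => if h : r < m then t ⟨r, h⟩ else 0
  have ht' : ∀ r (h : r < m), t' r = t ⟨r, h⟩ := fun r h => dif_pos h
  have hpq : ∀ r < m, (p r : ℕ) + 1 = q r := by
    intro r h
    rw [hp r h, hq r h]
    have := hii ⟨r, h⟩
    simp only [pf, qf]
    omega
  -- v side
  let u : ℕ → Equiv.Perm (Fin n) := fun r => vseq ii v (m - r)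
  have hvs : ∀ r (h : r < m), u r = if len (u (r + 1) * Equiv.swap (p r) (q r)) < len (u (r + 1))
      then u (r + 1) * Equiv.swap (p r) (q r) else u (r + 1) := by
    intro r h
    have e : m - r = (m - (r + 1)) + 1 := by omega
    have e2 : m - (m - (r + 1)) - 1 = r := by omega
    have h3 : m - (m - (r + 1)) - 1 < m := by omega
    have e4 : (⟨m - (m - (r + 1)) - 1, h3⟩ : Fin m) = ⟨r, h⟩ := Fin.ext e2
    simp only [u]
    rw [e, vseq, dif_pos h3, e4, hsp r h]
  have hJu : ∀ r (h : r < m), J r ↔ u r = u (r + 1) := by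
    intro r h
    rw [hJ r h]
    unfold inJ
    simp only [u]
    rw [Nat.sub_sub]
  have hnepq : ∀ r < m, p r ≠ q r := by
    intro r h h2
    have := hpq r h
    rw [h2] at this
    omega
  have hu1 : ∀ r < m, J r → u (r + 1) = u r := fun r h hj => ((hJu r h).mp hj).symm
  have hu2 : ∀ r < m, ¬ J r → u (r + 1) = u r * Equiv.swap (p r) (q r) := by
    intro r h hj
    have h1 := hvs r h
    split_ifs at h1 with h2
    · rw [h1]; simp [mul_assoc]
    · exact absurd ((hJu r h).mpr h1) hj
  have hu3 : ∀ r < m, u r (p r) < u r (q r) := by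
    intro r h
    have h1 := hvs r h
    have hne := hnepq r h
    split_ifs at h1 with h2
    · rw [h1]
      simp only [Equiv.Perm.mul_apply, Equiv.swap_apply_left, Equiv.swap_apply_right]
      by_contra hc
      have h4 : u (r + 1) (p r) < u (r + 1) (q r) :=
        lt_of_le_of_ne (not_lt.mp hc) (fun h => hne ((u (r+1)).injective h))
      have := len_mul_swap (hpq r h) _ h4
      omega
    · rw [h1]
      by_contra hc
      have h4 : u (r + 1) (q r) < u (r + 1) (p r) :=
        lt_of_le_of_ne (not_lt.mp hc) (fun h => hne ((u (r+1)).injective h).symm)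
      have := len_mul_swap' (hpq r h) _ h4
      omega
  -- w side
  let ww : ℕ → Equiv.Perm (Fin n) := fun r => ((sPermList n ii).take r).prod
  have hw2 : ∀ r < m, ww (r + 1) = ww r * Equiv.swap (p r) (q r) := by
    intro r h
    simp only [ww, sPermList]
    rw [take_prod _ r h, hsp r h]
  have hwm : len (ww m) = m := by
    have : ww m = w := by
      simp only [ww]
      rw [hw, List.take_of_length_le (by simp [sPermList])]
    rw [this, hred]
  have hstep : ∀ r < m, len (ww (r + 1)) ≤ len (ww r) + 1 := by
    intro r h
    rw [hw2 r h]
    rcases lt_or_gt_of_ne (fun h' => hnepq r h ((ww r).injective h')) with h1 | h1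
    · exact (len_mul_swap (hpq r h) _ h1).le
    · have := len_mul_swap' (hpq r h) _ h1
      omega
  have hup : ∀ r ≤ m, len (ww r) ≤ r := by
    intro r
    induction r with
    | zero => intro _; simp [ww, len_one]
    | succ r ih => intro hr; have := hstep r hr; have := ih (by omega); omega
  have hdown : ∀ r ≤ m, r ≤ len (ww r) := by
    apply down_ind
    · rw [hwm]
    · intro r hr ih; have := hstep r hr; omega
  have hw3 : ∀ r < m, ww r (p r) < ww r (q r) := by
    intro r h
    rcases lt_or_gt_of_ne (fun h' => hnepq r h ((ww r).injective h')) with h1 | h1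
    · exact h1
    · have h2 := len_mul_swap' (hpq r h) _ h1
      rw [← hw2 r h] at h2
      have := hup r h.le
      have := hdown (r + 1) h
      omega
  let G : ℕ → Matrix (Fin n) (Fin n) ℂ := fun r => ((mrgList ii v t).drop r).prod
  let W : ℕ → Matrix (Fin n) (Fin n) ℂ := fun r => ((sdotList n ii).drop r).prod
  let A : ℕ → Equiv.Perm (Fin n) := fun r => ((svPermList ii v).drop r).reverse.prod
  let B : ℕ → Equiv.Perm (Fin n) := fun r => ((sPermList n ii).drop r).reverse.prod
  have hmain := core hpq hu1 hu2 hu3 hw2 hw3 t'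
    (fun r h hj => by rw [ht' r h]; exact ht _ ((hJ r h).mp hj)) G W
    (by simp only [G, mrgList, drop_ofFn_nil]; simp)
    (fun r h hj => by
      simp only [G, mrgList]
      rw [drop_prod _ r h, if_pos ((hJ r h).mp hj), ht' r h, hqi r h])
    (fun r h hj => by
      simp only [G, mrgList]
      rw [drop_prod _ r h, if_neg (fun h' => hj ((hJ r h).mpr h')), hqi r h])
    (by simp only [W, sdotList, drop_ofFn_nil]; simp)
    (fun r h => by
      simp only [W, sdotList]
      rw [drop_prod _ r h, hqi r h])
    A B (by simp only [A, svPermList, drop_ofFn_nil]; simp)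
    (fun r h hj => by
      simp only [A, svPermList]
      rw [drop_prod_rev _ r h, if_pos ((hJ r h).mp hj), mul_one])
    (fun r h hj => by
      simp only [A, svPermList]
      rw [drop_prod_rev _ r h, if_neg (fun h' => hj ((hJ r h).mpr h')), hsp r h])
    (by simp only [B, sPermList, drop_ofFn_nil]; simp)
    (fun r h => by
      simp only [B, sPermList]
      rw [drop_prod_rev _ r h, hsp r h])
  have hG0 : G 0 = mrg ii v t := by simp [G, mrg]
  have hW0 : W 0 = wMR n ii := by simp [W, wMR]
  rw [hG0, hW0] at hmain
  refine ⟨hmain.1, ?_⟩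
  intro a b c hU r hr
  obtain ⟨f, hf1, hf2⟩ := hmain.2 a b c hU
  obtain ⟨r, hrm⟩ := r
  have hlow : ∀ k : ℕ, ∀ a ∈ (univ.filter fun x : Fin n => (x : ℕ) < k), ∀ b, b < a →
      b ∈ (univ.filter fun x : Fin n => (x : ℕ) < k) := by
    intro k a ha b hb
    simp only [Finset.mem_filter, Finset.mem_univ, true_and] at ha ⊢
    rw [Fin.lt_def] at hb
    omega
  intro σv σw τv τw
  have e1 := fun k => hf1 (r + 1) hrm _ (hlow k)
  have e2 := fun k => hf1 r hrm.le _ (hlow k)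
  have e1' : ∀ k, minor a ((univ.filter fun x : Fin n => (x : ℕ) < k).image ⇑σv)
      ((univ.filter fun x : Fin n => (x : ℕ) < k).image ⇑σw)
      = ∏ x ∈ (univ.filter fun x : Fin n => (x : ℕ) < k), f (r + 1) x := e1
  have e2' : ∀ k, minor a ((univ.filter fun x : Fin n => (x : ℕ) < k).image ⇑τv)
      ((univ.filter fun x : Fin n => (x : ℕ) < k).image ⇑τw)
      = ∏ x ∈ (univ.filter fun x : Fin n => (x : ℕ) < k), f r x := e2
  rw [e1', e1', e1', e2']
  have hf := hf2 r hrm ((hJ r hrm).mpr hr)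
  have htr : t ⟨r, hrm⟩ ≠ 0 := ht _ hr
  rw [ht' r hrm] at hf
  have hq' := hqi r hrm
  have hp' := hpq r hrm
  rw [← hq']
  have hne := hnepq r hrm
  have s1 : (univ.filter fun x : Fin n => (x : ℕ) < (q r : ℕ) + 1)
      = insert (q r) (univ.filter fun x : Fin n => (x : ℕ) < (q r : ℕ)) := by
    ext x; simp only [Finset.mem_filter, Finset.mem_univ, true_and, Finset.mem_insert, Fin.ext_iff]
    omega
  have s2 : (univ.filter fun x : Fin n => (x : ℕ) < (q r : ℕ))
      = insert (p r) (univ.filter fun x : Fin n => (x : ℕ) < (q r : ℕ) - 1) := by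
    ext x; simp only [Finset.mem_filter, Finset.mem_univ, true_and, Finset.mem_insert, Fin.ext_iff]
    omega
  rw [s1, Finset.prod_insert (by simp), s2, Finset.prod_insert, Finset.prod_insert]
  · have h3 : ∏ x ∈ (univ.filter fun x : Fin n => (x : ℕ) < (q r : ℕ) - 1), f (r + 1) x
        = ∏ x ∈ (univ.filter fun x : Fin n => (x : ℕ) < (q r : ℕ) - 1), f r x := by
      apply Finset.prod_congr rfl
      intro x hx
      simp only [Finset.mem_filter, Finset.mem_univ, true_and] at hx
      have h1 : x ≠ p r := by intro h; rw [h] at hx; omega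
      have h2 : x ≠ q r := by intro h; rw [h] at hx; omega
      rw [hf, if_neg h1, if_neg h2, one_mul, Equiv.swap_apply_of_ne_of_ne h1 h2]
    have h4 := hf (q r)
    rw [if_neg hne.symm, if_pos rfl, Equiv.swap_apply_right] at h4
    rw [h3, h4]
    ring
  · simp only [Finset.mem_filter, Finset.mem_univ, true_and]; omega
  · simp only [Finset.mem_filter, Finset.mem_univ, true_and]; omega

end
end Paper
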